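/- Let D be a domain-independent, union-closed, strongly first order k-ary dependency, and let D(R) be a first-order sentence over the signature {R} defining D (i.e. (A,R) ∈ D iff (A,R) ⊨ D(R)). Then D(R) is logically equivalent to some finite disjunction of U-sentences over the signature {R}. -/

import Mathlib

open FirstOrder FirstOrder.Language

/-- A `k`-ary dependency: an isomorphism-closed class of models `(A, R)` where `R` is a
`k`-ary relation on the domain `A`. -/
structure Dependency (k : ℕ) : Type 1 where
  Mem : ∀ (A : Type), Set (Fin k → A) → Prop
  iso_closed : ∀ {A B : Type} (e : A ≃ B) (R : Set (Fin k → A)),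
    Mem A R → Mem B ((fun (t : Fin k → A) (i : Fin k) => e (t i)) '' R)

/-- `Fld R` is the set of all elements occurring in some position of some tuple of `R`. -/
def Fld {k : ℕ} {A : Type} (R : Set (Fin k → A)) : Set A :=
  {a | ∃ t ∈ R, ∃ i, t i = a}

/-- A dependency is domain independent if `(A, R) ∈ D ↔ (Fld R, R) ∈ D`. -/
def Dependency.DomainIndependent {k : ℕ} (D : Dependency k) : Prop :=
  ∀ (A : Type) (R : Set (Fin k → A)),
    D.Mem A R ↔ D.Mem (Fld R) {t : Fin k → (Fld R) | (fun i => (t i : A)) ∈ R}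

/-- A dependency is union closed if it is closed under unions of arbitrary
(possibly empty) families of relations on a fixed domain. -/
def Dependency.UnionClosed {k : ℕ} (D : Dependency k) : Prop :=
  ∀ (A : Type) (I : Type) (R : I → Set (Fin k → A)),
    (∀ i, D.Mem A (R i)) → D.Mem A (⋃ i, R i)

def Dependency.DownwardsClosed {k : ℕ} (D : Dependency k) : Prop :=
  ∀ (A : Type) (R S : Set (Fin k → A)), D.Mem A R → S ⊆ R → D.Mem A S

def Dependency.UpwardsClosed {k : ℕ} (D : Dependency k) : Prop :=
  ∀ (A : Type) (R S : Set (Fin k → A)), D.Mem A R → R ⊆ S → D.Mem A S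

def Dependency.EmptyTeamProperty {k : ℕ} (D : Dependency k) : Prop :=
  ∀ A : Type, D.Mem A (∅ : Set (Fin k → A))

/-- `teamMap X xs` is `X(x⃗)`: the set of values of the tuple of variables `xs` over the team `X`. -/
def teamMap {M : Type} (X : Set (ℕ → M)) {n : ℕ} (xs : Fin n → ℕ) : Set (Fin n → M) :=
  {t | ∃ s ∈ X, t = fun j => s (xs j)}

/-- Formulas of `FO(𝒟)` in negation normal form, over the language `L`, with variables in `ℕ`,
where `𝒟` is the family of dependencies `(Ds i)_{i : ι}`. -/
inductive TSFormula (L : FirstOrder.Language.{0,0}) {ι : Type} (Ds : ι → (k : ℕ) × Dependency k) : Type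
  | rel {n : ℕ} (r : L.Relations n) (ts : Fin n → L.Term ℕ)
  | nrel {n : ℕ} (r : L.Relations n) (ts : Fin n → L.Term ℕ)
  | equal (t₁ t₂ : L.Term ℕ)
  | nequal (t₁ t₂ : L.Term ℕ)
  | depAtom (i : ι) (xs : Fin (Ds i).1 → ℕ)
  | conj (φ ψ : TSFormula L Ds)
  | disj (φ ψ : TSFormula L Ds)
  | ex (v : ℕ) (φ : TSFormula L Ds)
  | fa (v : ℕ) (φ : TSFormula L Ds)

variable {L : FirstOrder.Language.{0,0}} {ι : Type} {Ds : ι → (k : ℕ) × Dependency k}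

/-- Team semantics for `FO(𝒟)`. -/
def TSFormula.Sat (M : Type) [L.Structure M] : TSFormula L Ds → Set (ℕ → M) → Prop
  | .rel r ts, X => ∀ s ∈ X, Structure.RelMap r (fun i => (ts i).realize s)
  | .nrel r ts, X => ∀ s ∈ X, ¬ Structure.RelMap r (fun i => (ts i).realize s)
  | .equal t₁ t₂, X => ∀ s ∈ X, t₁.realize s = t₂.realize s
  | .nequal t₁ t₂, X => ∀ s ∈ X, t₁.realize s ≠ t₂.realize s
  | .depAtom i xs, X => (Ds i).2.Mem M (teamMap X xs)
  | .conj φ ψ, X => φ.Sat M X ∧ ψ.Sat M X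
  | .disj φ ψ, X => ∃ Y Z : Set (ℕ → M), X = Y ∪ Z ∧ φ.Sat M Y ∧ ψ.Sat M Z
  | .ex v φ, X => ∃ H : (ℕ → M) → Set M, (∀ s ∈ X, (H s).Nonempty) ∧
      φ.Sat M {s' | ∃ s ∈ X, ∃ m ∈ H s, s' = Function.update s v m}
  | .fa v φ, X => φ.Sat M {s' | ∃ s ∈ X, ∃ m : M, s' = Function.update s v m}

/-- The set of variables of a first-order term. -/
def termVars : L.Term ℕ → Set ℕ
  | .var x => {x}
  | .func _f ts => ⋃ i, termVars (ts i)

/-- The free variables of a team-semantics formula. -/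
def TSFormula.freeVars : TSFormula L Ds → Set ℕ
  | .rel _ ts => ⋃ i, termVars (ts i)
  | .nrel _ ts => ⋃ i, termVars (ts i)
  | .equal t₁ t₂ => termVars t₁ ∪ termVars t₂
  | .nequal t₁ t₂ => termVars t₁ ∪ termVars t₂
  | .depAtom _ xs => Set.range xs
  | .conj φ ψ => φ.freeVars ∪ ψ.freeVars
  | .disj φ ψ => φ.freeVars ∪ ψ.freeVars
  | .ex v φ => φ.freeVars \ {v}
  | .fa v φ => φ.freeVars \ {v}

/-- A sentence of `FO(𝒟)` is true in `M` iff it is satisfied by the team containing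
only one assignment (for sentences, the choice of assignment is irrelevant). -/
def TSFormula.TrueIn (M : Type) [L.Structure M] (φ : TSFormula L Ds) : Prop :=
  ∀ s : ℕ → M, φ.Sat M {s}

/-- A family of dependencies is strongly first order iff every sentence of `FO(𝒟)`,
over any (Type-0) signature, is equivalent to some first-order sentence. -/
def StronglyFirstOrderFamily {ι : Type} (Ds : ι → (k : ℕ) × Dependency k) : Prop :=
  ∀ (L : FirstOrder.Language.{0,0}) (φ : TSFormula L Ds), φ.freeVars = ∅ →
    ∃ ψ : L.Sentence, ∀ (M : Type) [L.Structure M] [Nonempty M],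
      (φ.TrueIn M ↔ Sentence.Realize M ψ)

/-- A single dependency is strongly first order iff every sentence of `FO(D)`
is equivalent to some first-order sentence. -/
def StronglyFirstOrder {k : ℕ} (D : Dependency k) : Prop :=
  StronglyFirstOrderFamily (fun _ : Unit => ⟨k, D⟩)

/-- The signature `{R}` with a single `k`-ary relation symbol. -/
def relLang (k : ℕ) : FirstOrder.Language.{0,0} where
  Functions := fun _ => Empty
  Relations := fun n => PLift (n = k)

/-- The `{R}`-structure on `A` in which `R` is interpreted as the `k`-ary relation `R`. -/
def relStructure {k : ℕ} (A : Type) (R : Set (Fin k → A)) : (relLang k).Structure A where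
  funMap := fun f _ => f.elim
  RelMap := fun {n} r x => (fun i : Fin k => x (Fin.cast r.down.symm i)) ∈ R

/-- A dependency is first order if, as a property of relations, it is definable by a
first-order sentence over the signature `{R}`. -/
def Dependency.IsFirstOrder {k : ℕ} (D : Dependency k) : Prop :=
  ∃ ψ : (relLang k).Sentence,
    ∀ (A : Type) [Nonempty A] (R : Set (Fin k → A)),
      D.Mem A R ↔ (letI := relStructure A R; Sentence.Realize A ψ)

/-- The signature `{a₁, …, a_c}` consisting of `c` constant symbols (and no relations
other than equality). -/
def constLang (c : ℕ) : FirstOrder.Language.{0,0} where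
  Functions := fun n => match n with
    | 0 => Fin c
    | _ + 1 => Empty
  Relations := fun _ => Empty

/-- The `{a⃗}`-structure on `A` interpreting the constants as `cs`. -/
def constStructure {c : ℕ} (A : Type) (cs : Fin c → A) : (constLang c).Structure A where
  funMap := fun {n} f _ => match n, f with
    | 0, i => cs i
    | _ + 1, f => f.elim
  RelMap := fun {_} r => r.elim

/-- Since the signature `{R, a⃗}` has no function symbols of positive arity, every term over it
is a variable or a constant; a term with variables among `x⃗ = (x₁ … x_m)` is an element of
`Fin m ⊕ Fin c`. Its evaluation under `x : Fin m → A` and constants `cs : Fin c → A` is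
`Sum.elim x cs`. A literal over `{R, a⃗}` with variables among `x⃗` in which `R` occurs only
positively is an equality, an inequality, or a positive `R`-atom. -/
inductive ULit (k c m : ℕ) : Type
  | eq (t₁ t₂ : Fin m ⊕ Fin c)
  | ne (t₁ t₂ : Fin m ⊕ Fin c)
  | rel (ts : Fin k → (Fin m ⊕ Fin c))

/-- Realization of a literal in the model `(A, R, cs)` under the assignment `x` to `x⃗`. -/
def ULit.Realize {k c m : ℕ} {A : Type} (R : Set (Fin k → A)) (cs : Fin c → A)
    (x : Fin m → A) : ULit k c m → Prop
  | .eq t₁ t₂ => Sum.elim x cs t₁ = Sum.elim x cs t₂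
  | .ne t₁ t₂ => Sum.elim x cs t₁ ≠ Sum.elim x cs t₂
  | .rel ts => (fun j => Sum.elim x cs (ts j)) ∈ R

/-- A U-sentence over the signature `{R, a⃗}`: a sentence of the form
`∃x⃗(η(x⃗) ∧ ∀y⃗(R y⃗ → θ(x⃗, y⃗)))`, where `η` is a conjunction of literals in which `R` occurs
only positively and `θ` is a first-order formula over `{a⃗}` (in which `R` does not occur)
with free variables among the disjoint tuples `x⃗` (of length `m`) and `y⃗` (of length `k`). -/
structure USentence (k c : ℕ) : Type where
  m : ℕ
  η : List (ULit k c m)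
  θ : (constLang c).Formula ((Fin m) ⊕ (Fin k))

/-- Realization of a U-sentence in the model `(A, R, cs)`. -/
def USentence.Realize {k c : ℕ} (A : Type) (R : Set (Fin k → A)) (cs : Fin c → A)
    (χ : USentence k c) : Prop :=
  letI := constStructure A cs
  ∃ x : Fin χ.m → A,
    (∀ l ∈ χ.η, ULit.Realize R cs x l) ∧
    ∀ y ∈ R, χ.θ.Realize (Sum.elim x y)

section Ultraproducts

variable {α : Type} {M : α → Type} {u : Ultrafilter α} {k : ℕ}

/-- The element of the ultraproduct represented by a choice function. -/
def ultraMk (u : Ultrafilter α) (x : ∀ a, M a) : (u : Filter α).Product M := x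

theorem exists_rep_tuple {n : ℕ} (t : Fin n → (u : Filter α).Product M) :
    ∃ x : Fin n → ∀ a, M a, t = fun i => ultraMk u (x i) := by
  choose x hx using fun i => Quotient.exists_rep (t i)
  exact ⟨x, funext fun i => (hx i).symm⟩

theorem cast_eq_cast_iff (x y : ∀ a, M a) :
    ultraMk u x = ultraMk u y ↔ ∀ᶠ a in (u : Filter α), x a = y a :=
  Quotient.eq''

theorem cast_tuple_eq_iff {n : ℕ} (x y : Fin n → ∀ a, M a) :
    (fun i => ultraMk u (x i)) = (fun i => ultraMk u (y i)) ↔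
      ∀ᶠ a in (u : Filter α), (fun i => x i a) = fun i => y i a := by
  simp only [funext_iff, cast_eq_cast_iff, Filter.eventually_all]

/-- The ultraproduct of a family of relations, as a relation on the ultraproduct of the domains. -/
def ultraRel (u : Ultrafilter α) (R : ∀ a, Set (Fin k → M a)) :
    Set (Fin k → (u : Filter α).Product M) :=
  {t | ∃ x : Fin k → ∀ a, M a, t = (fun i => ultraMk u (x i)) ∧
    ∀ᶠ a in (u : Filter α), (fun i => x i a) ∈ R a}

theorem cast_mem_ultraRel (R : ∀ a, Set (Fin k → M a)) (x : Fin k → ∀ a, M a) :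
    (fun i => ultraMk u (x i)) ∈ ultraRel u R ↔
      ∀ᶠ a in (u : Filter α), (fun i => x i a) ∈ R a := by
  constructor
  · rintro ⟨y, hy, h⟩
    filter_upwards [(cast_tuple_eq_iff x y).1 hy, h] with a h1 h2
    rwa [h1]
  · exact fun h => ⟨x, rfl, h⟩

theorem realize_ultraRel [∀ a, Nonempty (M a)] (R : ∀ a, Set (Fin k → M a))
    (ψ : (relLang k).Sentence) :
    (letI := relStructure _ (ultraRel u R);
      Sentence.Realize ((u : Filter α).Product M) ψ) ↔
      ∀ᶠ a in (u : Filter α), (letI := relStructure _ (R a); Sentence.Realize (M a) ψ) := by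
  let inst : ∀ a, (relLang k).Structure (M a) := fun a => relStructure _ (R a)
  have key : relStructure _ (ultraRel u R) =
      (Ultraproduct.structure : (relLang k).Structure ((u : Filter α).Product M)) := by
    ext n r x
    · exact r.elim
    · obtain ⟨x, rfl⟩ := exists_rep_tuple x
      refine (cast_mem_ultraRel R (fun i => x (Fin.cast r.down.symm i))).trans ?_
      exact (relMap_quotient_mk' (s := (u : Filter α).productSetoid M) r x).symm
  rw [key]
  exact Ultraproduct.sentence_realize ψ

theorem realize_constLang_zero [∀ a, Nonempty (M a)] {β : Type}
    (θ : (constLang 0).Formula β) (x : β → ∀ a, M a) :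
    (letI := constStructure ((u : Filter α).Product M) Fin.elim0;
      θ.Realize fun i => ultraMk u (x i)) ↔
      ∀ᶠ a in (u : Filter α),
        (letI := constStructure (M a) Fin.elim0; θ.Realize fun i => x i a) := by
  let inst : ∀ a, (constLang 0).Structure (M a) := fun a => constStructure _ Fin.elim0
  have key : constStructure _ Fin.elim0 =
      (Ultraproduct.structure : (constLang 0).Structure ((u : Filter α).Product M)) := by
    ext n r x
    · match n, r with
      | 0, r => exact r.elim0
      | _ + 1, r => exact r.elim
    · exact r.elim
  rw [key]
  exact Ultraproduct.realize_formula_cast θ x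

theorem USentence.eventually_realize [∀ a, Nonempty (M a)] (R : ∀ a, Set (Fin k → M a))
    (χ : USentence k 0)
    (h : χ.Realize ((u : Filter α).Product M) (ultraRel u R) Fin.elim0) :
    ∀ᶠ a in (u : Filter α), χ.Realize (M a) (R a) Fin.elim0 := by
  obtain ⟨x, hη, hθ⟩ := h
  obtain ⟨x, rfl⟩ := exists_rep_tuple x
  have hη' : ∀ᶠ a in (u : Filter α), ∀ l ∈ χ.η, l.Realize (R a) Fin.elim0 fun i => x i a := by
    refine (Filter.eventually_all_finite (List.finite_toSet χ.η)).2 fun l hl => ?_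
    have hr := hη l hl
    have term : ∀ t : Fin χ.m ⊕ Fin 0,
        Sum.elim (fun i => ultraMk u (x i)) Fin.elim0 t =
          ultraMk u (fun a => Sum.elim (fun i => x i a) Fin.elim0 t) := by
      rintro (t | t)
      · rfl
      · exact t.elim0
    cases l with
    | eq t₁ t₂ =>
      simp only [ULit.Realize] at hr ⊢
      rwa [term, term, cast_eq_cast_iff] at hr
    | ne t₁ t₂ =>
      simp only [ULit.Realize] at hr ⊢
      rw [ne_eq, term, term, cast_eq_cast_iff] at hr
      exact Ultrafilter.eventually_not.2 hr
    | rel ts =>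
      simp only [ULit.Realize] at hr ⊢
      simp only [term] at hr
      exact (cast_mem_ultraRel R _).1 hr
  have hθ' : ∀ᶠ a in (u : Filter α), ∀ y ∈ R a,
      (letI := constStructure (M a) Fin.elim0; χ.θ.Realize (Sum.elim (fun i => x i a) y)) := by
    by_contra hne
    have hne' := Ultrafilter.eventually_not.2 hne
    have hy : ∀ a, ∃ y : Fin k → M a, (¬ ∀ y ∈ R a,
        (letI := constStructure (M a) Fin.elim0;
          χ.θ.Realize (Sum.elim (fun i => x i a) y))) → y ∈ R a ∧
        ¬ (letI := constStructure (M a) Fin.elim0;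
          χ.θ.Realize (Sum.elim (fun i => x i a) y)) := by
      intro a
      by_cases ha : ∀ y ∈ R a, (letI := constStructure (M a) Fin.elim0;
          χ.θ.Realize (Sum.elim (fun i => x i a) y))
      · exact ⟨fun _ => Classical.arbitrary _, fun h => (h ha).elim⟩
      · push Not at ha
        obtain ⟨y, hy⟩ := ha
        exact ⟨y, fun _ => hy⟩
    choose y hy using hy
    have hyR : (fun i => ultraMk u (fun a => y a i)) ∈
        ultraRel u R := (cast_mem_ultraRel R _).2 (hne'.mono fun a ha => (hy a ha).1)
    have hr := hθ _ hyR
    have he : Sum.elim (fun i => ultraMk u (x i))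
        (fun i => ultraMk u (fun a => y a i)) =
        fun i => ultraMk u (Sum.elim x (fun i a => y a i) i) := by
      funext i
      cases i <;> rfl
    rw [he] at hr
    have hr' := (realize_constLang_zero χ.θ _).1 hr
    obtain ⟨a, ha, hb⟩ := (hr'.and hne').exists
    refine (hy a hb).2 ?_
    convert ha using 1
    funext i
    cases i <;> rfl
  filter_upwards [hη', hθ'] with a h1 h2
  exact ⟨fun i => x i a, h1, h2⟩

end Ultraproducts

section Transport

variable {k : ℕ} {D : Dependency k}

theorem Dependency.DomainIndependent.mem_range_of_mem_range (hdi : D.DomainIndependent)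
    {κ A B : Type} {u : κ → Fin k → A} {v : κ → Fin k → B}
    (h : ∀ p q i j, u p i = u q j ↔ v p i = v q j) (hu : D.Mem A (Set.range u)) :
    D.Mem B (Set.range v) := by
  have hF : ∀ a : Fld (Set.range u), ∃ p i, u p i = a := by
    rintro ⟨a, _, ⟨p, rfl⟩, i, hi⟩
    exact ⟨p, i, hi⟩
  choose P I hPI using hF
  let e₀ : Fld (Set.range u) → Fld (Set.range v) := fun a =>
    ⟨v (P a) (I a), v (P a), ⟨P a, rfl⟩, I a, rfl⟩
  have he₀ : ∀ (a : Fld (Set.range u)) (p : κ) (i : Fin k), u p i = a → (e₀ a : B) = v p i := by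
    intro a p i ha
    exact (h _ _ _ _).1 ((hPI a).trans ha.symm)
  have hbij : Function.Bijective e₀ := by
    constructor
    · intro a b hab
      have := (h _ _ _ _).2 (congrArg Subtype.val hab)
      exact Subtype.ext ((hPI a).symm.trans (this.trans (hPI b)))
    · rintro ⟨b, _, ⟨p, rfl⟩, i, rfl⟩
      exact ⟨⟨u p i, u p, ⟨p, rfl⟩, i, rfl⟩, Subtype.ext (he₀ _ p i rfl)⟩
  refine (hdi B _).2 ?_
  convert D.iso_closed (Equiv.ofBijective e₀ hbij) _ ((hdi A _).1 hu) using 1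
  ext t
  constructor
  · rintro ⟨p, hp⟩
    refine ⟨fun i => ⟨u p i, u p, ⟨p, rfl⟩, i, rfl⟩, ⟨p, rfl⟩, ?_⟩
    funext i
    refine Subtype.ext ((he₀ _ p i rfl).trans ?_)
    exact congrFun hp i
  · rintro ⟨t, ⟨p, hp⟩, rfl⟩
    refine ⟨p, ?_⟩
    funext i
    exact (he₀ _ p i (congrFun hp i)).symm

theorem Dependency.DomainIndependent.mem_image_iff (hdi : D.DomainIndependent)
    {A B : Type} {f : A → B} (hf : Function.Injective f) (R : Set (Fin k → A)) :
    D.Mem B ((fun t i => f (t i)) '' R) ↔ D.Mem A R := by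
  have hR : R = Set.range (Subtype.val : R → Fin k → A) := Subtype.range_coe.symm
  have hfR : (fun t i => f (t i)) '' R = Set.range fun (p : R) i => f (p.1 i) := by
    rw [Set.image_eq_range]
  rw [hfR]
  conv_rhs => rw [hR]
  constructor
  · exact hdi.mem_range_of_mem_range fun p q i j => hf.eq_iff
  · exact hdi.mem_range_of_mem_range fun p q i j => hf.eq_iff.symm

theorem Dependency.UnionClosed.union (huc : D.UnionClosed) {A : Type} {R S : Set (Fin k → A)}
    (hR : D.Mem A R) (hS : D.Mem A S) : D.Mem A (R ∪ S) := by
  rw [Set.union_eq_iUnion]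
  refine huc A Bool _ ?_
  rintro (_ | _) <;> assumption

end Transport

section TeamSemantics

/-- Existential quantification over the variables `0, …, n - 1`. -/
def TSFormula.exPrefix {K : FirstOrder.Language.{0,0}} {κ : Type}
    {Es : κ → (k : ℕ) × Dependency k} : ℕ → TSFormula K Es → TSFormula K Es
  | 0, φ => φ
  | n + 1, φ => exPrefix n (.ex n φ)

variable {K : FirstOrder.Language.{0,0}} {κ : Type} {Es : κ → (k : ℕ) × Dependency k}
  {M : Type} [K.Structure M]

theorem TSFormula.freeVars_exPrefix (n : ℕ) (φ : TSFormula K Es) :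
    (φ.exPrefix n).freeVars = φ.freeVars \ Set.Iio n := by
  induction n generalizing φ with
  | zero => simp [exPrefix]
  | succ n ih =>
    rw [exPrefix, ih, freeVars]
    ext i
    simp only [Set.mem_sdiff, Set.mem_singleton_iff, Set.mem_Iio]
    grind

theorem TSFormula.exists_sat_of_sat_exPrefix (n : ℕ) (φ : TSFormula K Es) (X : Set (ℕ → M))
    (hX : X.Nonempty) (h : (φ.exPrefix n).Sat M X) : ∃ T : Set (ℕ → M), T.Nonempty ∧ φ.Sat M T := by
  induction n generalizing φ with
  | zero => exact ⟨X, hX, h⟩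
  | succ n ih =>
    obtain ⟨T, ⟨s, hs⟩, H, hH, hT⟩ := ih _ h
    obtain ⟨m, hm⟩ := hH s hs
    refine ⟨_, ?_, hT⟩
    exact ⟨_, s, hs, m, hm, rfl⟩

theorem TSFormula.sat_exPrefix (n : ℕ) (φ : TSFormula K Es) (s : ℕ → M) (T : Set (ℕ → M))
    (hT : T.Nonempty) (hs : ∀ t ∈ T, ∀ i, n ≤ i → t i = s i) (h : φ.Sat M T) :
    (φ.exPrefix n).Sat M {s} := by
  induction n generalizing φ T with
  | zero =>
    have : T = {s} :=
      Set.eq_singleton_iff_nonempty_unique_mem.2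
        ⟨hT, fun t ht => funext fun i => hs t ht i (Nat.zero_le i)⟩
    rwa [this] at h
  | succ n ih =>
    refine ih _ ((fun t => Function.update t n (s n)) '' T) (hT.image _) ?_ ?_
    · rintro _ ⟨t, ht, rfl⟩ i hi
      rcases hi.eq_or_lt with rfl | hi
      · simp
      · exact (Function.update_of_ne hi.ne' _ _).trans (hs t ht i hi)
    · refine ⟨fun t' => {m | Function.update t' n m ∈ T}, ?_, ?_⟩
      · rintro _ ⟨t, ht, rfl⟩
        exact ⟨t n, by simpa using ht⟩
      · convert h using 1
        ext t
        constructor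
        · rintro ⟨t', _, m, hm, rfl⟩
          exact hm
        · intro ht
          exact ⟨_, ⟨t, ht, rfl⟩, t n, by simpa using ht, by simp⟩

variable {k : ℕ}

/-- The `FO(D)` sentence `∃x⃗ ∃y⃗ (Q x⃗ y⃗ ∧ D x⃗ ∧ D y⃗)`. -/
def linkFormula (D : Dependency k) :
    TSFormula (relLang (k + k)) (fun _ : Unit => (⟨k, D⟩ : (k : ℕ) × Dependency k)) :=
  .exPrefix (k + k) (.conj (.rel (n := k + k) ⟨rfl⟩ fun i => Term.var i.1)
    (.conj (.depAtom () fun i : Fin k => (Fin.castAdd k i).1)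
      (.depAtom () fun i : Fin k => (Fin.natAdd k i).1)))

theorem freeVars_linkFormula (D : Dependency k) : (linkFormula D).freeVars = ∅ := by
  rw [linkFormula, TSFormula.freeVars_exPrefix, Set.sdiff_eq_empty]
  simp only [TSFormula.freeVars, termVars, Set.union_subset_iff, Set.iUnion_subset_iff,
    Set.singleton_subset_iff, Set.mem_Iio, Set.range_subset_iff]
  exact ⟨fun i => i.2, fun i => (Fin.castAdd k i).2, fun i => (Fin.natAdd k i).2⟩

theorem trueIn_linkFormula_iff (D : Dependency k) [Nonempty M] (Q : Set (Fin (k + k) → M)) :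
    (letI := relStructure M Q; (linkFormula D).TrueIn M) ↔
      ∃ T ⊆ Q, T.Nonempty ∧ D.Mem M ((fun z i => z (Fin.castAdd k i)) '' T) ∧
        D.Mem M ((fun z i => z (Fin.natAdd k i)) '' T) := by
  let inst := relStructure M Q
  constructor
  · intro h
    obtain ⟨X, hX, hQ, hl, hr⟩ :=
      TSFormula.exists_sat_of_sat_exPrefix _ _ _ (Set.singleton_nonempty _)
        (h fun _ => Classical.arbitrary M)
    refine ⟨(fun (s : ℕ → M) (i : Fin (k + k)) => s i) '' X, ?_, hX.image _, ?_, ?_⟩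
    · rintro _ ⟨s, hs, rfl⟩
      exact hQ s hs
    · refine (congrArg (D.Mem M) ?_).mp hl
      ext t
      simp [teamMap, eq_comm]
    · refine (congrArg (D.Mem M) ?_).mp hr
      ext t
      simp [teamMap, eq_comm]
  · rintro ⟨T, hTQ, ⟨z₀, hz₀⟩, hl, hr⟩ s
    let ext : (Fin (k + k) → M) → ℕ → M := fun z i => if h : i < k + k then z ⟨i, h⟩ else s i
    have hext : ∀ z (i : Fin (k + k)), ext z i = z i := fun z i => by simp [ext]
    refine TSFormula.sat_exPrefix _ _ s (ext '' T) ⟨_, z₀, hz₀, rfl⟩ ?_ ⟨?_, ?_, ?_⟩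
    · rintro _ ⟨z, hz, rfl⟩ i hi
      simp [ext, hi.not_gt]
    · rintro _ ⟨z, hz, rfl⟩
      have : (fun i : Fin (k + k) => ext z i) ∈ Q := by
        simp only [hext]
        exact hTQ hz
      exact this
    · refine (congrArg (D.Mem M) ?_).mp hl
      ext t
      constructor
      · rintro ⟨z, hz, rfl⟩
        exact ⟨_, ⟨z, hz, rfl⟩, funext fun i => (hext z (Fin.castAdd k i)).symm⟩
      · rintro ⟨_, ⟨z, hz, rfl⟩, rfl⟩
        exact ⟨z, hz, funext fun i => (hext z (Fin.castAdd k i)).symm⟩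
    · refine (congrArg (D.Mem M) ?_).mp hr
      ext t
      constructor
      · rintro ⟨z, hz, rfl⟩
        exact ⟨_, ⟨z, hz, rfl⟩, funext fun i => (hext z (Fin.natAdd k i)).symm⟩
      · rintro ⟨_, ⟨z, hz, rfl⟩, rfl⟩
        exact ⟨z, hz, funext fun i => (hext z (Fin.natAdd k i)).symm⟩

end TeamSemantics

section Chains

variable {k : ℕ} {D : Dependency k}

/-- `R 0 ⊆ R 1 ⊆ ⋯ ⊆ R n` is a chain of relations, all but possibly the last of which satisfy `D`,
each of them failing to satisfy `D` when expanded by a tuple of the next one. -/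
def Dependency.IsBreakingChain (D : Dependency k) {M : Type} (n : ℕ) (R : ℕ → Set (Fin k → M))
    (t : ℕ → Fin k → M) : Prop :=
  ∀ i < n, D.Mem M (R i) ∧ ¬ D.Mem M (insert (t i) (R i)) ∧ R i ⊆ R (i + 1) ∧ t i ∈ R (i + 1)

theorem Dependency.IsBreakingChain.subset {M : Type} {n : ℕ} {R : ℕ → Set (Fin k → M)}
    {t : ℕ → Fin k → M} (h : D.IsBreakingChain n R t) {i j : ℕ} (hij : i ≤ j) (hj : j ≤ n) :
    R i ⊆ R j := by
  induction j, hij using Nat.le_induction with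
  | base => exact subset_rfl
  | succ j _ ih => exact (ih (by lia)).trans (h j (by lia)).2.2.1

/-- Either `x` is one of `t 0, …, t (n - 1)`, or `y` is some `t i` with `x ∈ R i`. -/
def IsLinked {M : Type} (R : ℕ → Set (Fin k → M)) (t : ℕ → Fin k → M) (n : ℕ)
    (x y : Fin k → M) : Prop :=
  ∃ i < n, x = t i ∨ x ∈ R i ∧ y = t i

/-- The pairs of tuples that are linked in both directions. -/
def linkRel {M : Type} (R : ℕ → Set (Fin k → M)) (t : ℕ → Fin k → M) (n : ℕ) :
    Set (Fin (k + k) → M) :=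
  {z | IsLinked R t n (fun i => z (Fin.castAdd k i)) (fun i => z (Fin.natAdd k i)) ∧
    IsLinked R t n (fun i => z (Fin.natAdd k i)) (fun i => z (Fin.castAdd k i))}

theorem Dependency.UnionClosed.eq_empty_of_subset_linkRel (huc : D.UnionClosed) {M : Type} {n : ℕ}
    {R : ℕ → Set (Fin k → M)} {t : ℕ → Fin k → M} (h : D.IsBreakingChain n R t)
    {T : Set (Fin (k + k) → M)} (hT : T ⊆ linkRel R t n)
    (hl : D.Mem M ((fun z i => z (Fin.castAdd k i)) '' T))
    (hr : D.Mem M ((fun z i => z (Fin.natAdd k i)) '' T)) : T = ∅ := by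
  by_contra hne
  obtain ⟨z, hz⟩ := Set.nonempty_iff_ne_empty.2 hne
  set X := (fun (z : Fin (k + k) → M) i => z (Fin.castAdd k i)) '' T with hX
  set Y := (fun (z : Fin (k + k) → M) i => z (Fin.natAdd k i)) '' T with hY
  have hex : ∃ i < n, t i ∈ X ∪ Y := by
    obtain ⟨i, hi, hx | ⟨-, hy⟩⟩ := (hT hz).1
    · exact ⟨i, hi, hx ▸ Or.inl ⟨z, hz, rfl⟩⟩
    · exact ⟨i, hi, hy ▸ Or.inr ⟨z, hz, rfl⟩⟩
  obtain ⟨i, ⟨hi, hti⟩, hmax⟩ : ∃ i, (i < n ∧ t i ∈ X ∪ Y) ∧ ∀ j < n, t j ∈ X ∪ Y → j ≤ i := by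
    classical
    obtain ⟨i₀, hi₀⟩ := hex
    refine ⟨Nat.findGreatest (fun i => i < n ∧ t i ∈ X ∪ Y) n,
      Nat.findGreatest_spec (P := fun i => i < n ∧ t i ∈ X ∪ Y) hi₀.1.le hi₀, fun j hj hjt => ?_⟩
    exact Nat.le_findGreatest hj.le ⟨hj, hjt⟩
  have key : ∀ W, D.Mem M W → t i ∈ W → W ⊆ X ∪ Y →
      (∀ x ∈ W, ∃ y ∈ X ∪ Y, IsLinked R t n x y) → False := by
    intro W hW htW hWXY hlink
    have hsub : W ⊆ insert (t i) (R i) := by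
      intro x hx
      obtain ⟨y, hy, j, hj, rfl | ⟨hxR, rfl⟩⟩ := hlink x hx
      · rcases (hmax j hj (hWXY hx)).eq_or_lt with rfl | hlt
        · exact Or.inl rfl
        · exact Or.inr (h.subset hlt hi.le (h j hj).2.2.2)
      · exact Or.inr (h.subset (hmax j hj hy) hi.le hxR)
    have heq : insert (t i) (R i) = W ∪ R i :=
      Set.Subset.antisymm
        (Set.insert_subset (Or.inl htW) Set.subset_union_right)
        (Set.union_subset hsub (Set.subset_insert _ _))
    exact (h i hi).2.1 (heq ▸ huc.union hW (h i hi).1)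
  rcases hti with hti | hti
  · refine key X hl hti Set.subset_union_left ?_
    rintro _ ⟨z, hz, rfl⟩
    exact ⟨_, Or.inr ⟨z, hz, rfl⟩, (hT hz).1⟩
  · refine key Y hr hti Set.subset_union_right ?_
    rintro _ ⟨z, hz, rfl⟩
    exact ⟨_, Or.inl ⟨z, hz, rfl⟩, (hT hz).2⟩

/-- `D` is defined by the first-order sentence `ψ`. -/
def Dependency.DefinedBy (D : Dependency k) (ψ : (relLang k).Sentence) : Prop :=
  ∀ (A : Type) [Nonempty A] (R : Set (Fin k → A)),
    D.Mem A R ↔ (letI := relStructure A R; Sentence.Realize A ψ)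

theorem Dependency.DefinedBy.mem_ultraRel_iff {ψ : (relLang k).Sentence} (hψ : D.DefinedBy ψ)
    {α : Type} {M : α → Type} (u : Ultrafilter α) [∀ a, Nonempty (M a)]
    (R : ∀ a, Set (Fin k → M a)) :
    D.Mem _ (ultraRel u R) ↔ ∀ᶠ a in (u : Filter α), D.Mem (M a) (R a) := by
  rw [hψ, realize_ultraRel]
  simp only [← hψ _ _]

theorem Dependency.exists_forall_not_isBreakingChain (huc : D.UnionClosed)
    (hsfo : StronglyFirstOrder D) {ψ : (relLang k).Sentence} (hψ : D.DefinedBy ψ) :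
    ∃ n, ∀ (M : Type) [Nonempty M] (R : ℕ → Set (Fin k → M)) (t : ℕ → Fin k → M),
      ¬ D.IsBreakingChain n R t := by
  by_contra! hc
  choose M hM R t h using hc
  let u : Ultrafilter ℕ := Ultrafilter.of Filter.atTop
  have hu : ∀ i, ∀ᶠ n in (u : Filter ℕ), i < n :=
    fun i => Ultrafilter.of_le _ (Filter.eventually_gt_atTop i)
  obtain ⟨χ, hχ⟩ := hsfo (relLang (k + k)) (linkFormula D) (freeVars_linkFormula D)
  let Q : ∀ n, Set (Fin (k + k) → M n) := fun n => linkRel (R n) (t n) n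
  have hfalse : ∀ n, ¬ (letI := relStructure (M n) (Q n); Sentence.Realize (M n) χ) := by
    intro n hn
    let inst := relStructure (M n) (Q n)
    obtain ⟨T, hTQ, hT, hl, hr⟩ := (trueIn_linkFormula_iff D (Q n)).1 ((hχ (M n)).2 hn)
    exact hT.ne_empty (huc.eq_empty_of_subset_linkRel (h n) hTQ hl hr)
  have hfalse' : ¬ (letI := relStructure _ (ultraRel u Q);
      Sentence.Realize ((u : Filter ℕ).Product M) χ) := by
    rw [realize_ultraRel]
    intro hn
    obtain ⟨n, hn⟩ := hn.exists
    exact hfalse n hn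
  let S : ℕ → Set (Fin k → (u : Filter ℕ).Product M) := fun i => ultraRel u fun n => R n i
  let τ : ℕ → Fin k → (u : Filter ℕ).Product M := fun i j => ultraMk u fun n => t n i j
  have hS : ∀ i, D.Mem _ (S i) := fun i =>
    (hψ.mem_ultraRel_iff u _).2 ((hu i).mono fun n hn => (h n i hn).1)
  have hτ : ∀ i, τ i ∈ S (i + 1) := fun i =>
    (cast_mem_ultraRel _ _).2 ((hu i).mono fun n hn => (h n i hn).2.2.2)
  have hQ : ∀ x ∈ ⋃ i, S i, ∃ y ∈ ⋃ i, S i, ∃ z z',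
      z ∈ ultraRel u Q ∧ z' ∈ ultraRel u Q ∧
      (fun i => z (Fin.castAdd k i)) = x ∧ (fun i => z (Fin.natAdd k i)) = y ∧
      (fun i => z' (Fin.castAdd k i)) = y ∧ (fun i => z' (Fin.natAdd k i)) = x := by
    intro x hx
    obtain ⟨i, hx⟩ := Set.mem_iUnion.1 hx
    obtain ⟨x, rfl⟩ := exists_rep_tuple x
    have hx' := (cast_mem_ultraRel _ _).1 hx
    refine ⟨τ i, Set.mem_iUnion.2 ⟨i + 1, hτ i⟩,
      fun j => ultraMk u (Fin.append x (fun j n => t n i j) j),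
      fun j => ultraMk u (Fin.append (fun j n => t n i j) x j), ?_, ?_, ?_, ?_, ?_, ?_⟩
    · refine (cast_mem_ultraRel _ _).2 ?_
      filter_upwards [hx', hu i] with n hxn hn
      refine ⟨⟨i, hn, Or.inr ⟨?_, ?_⟩⟩, i, hn, Or.inl ?_⟩
      · simpa only [Fin.append_left] using hxn
      · simp only [Fin.append_right]
      · simp only [Fin.append_right]
    · refine (cast_mem_ultraRel _ _).2 ?_
      filter_upwards [hx', hu i] with n hxn hn
      refine ⟨⟨i, hn, Or.inl ?_⟩, i, hn, Or.inr ⟨?_, ?_⟩⟩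
      · simp only [Fin.append_left]
      · simpa only [Fin.append_right] using hxn
      · simp only [Fin.append_left]
    all_goals simp only [Fin.append_left, Fin.append_right, τ]
  refine hfalse' ?_
  let inst := relStructure _ (ultraRel u Q)
  refine (hχ _).1 ((trueIn_linkFormula_iff D (ultraRel u Q)).2
    ⟨{z ∈ ultraRel u Q | (fun i => z (Fin.castAdd k i)) ∈ ⋃ i, S i ∧
      (fun i => z (Fin.natAdd k i)) ∈ ⋃ i, S i}, Set.sep_subset _ _, ?_, ?_, ?_⟩)
  · obtain ⟨y, hy, z, -, hz, -, h1, h2, -⟩ := hQ _ (Set.mem_iUnion.2 ⟨1, hτ 0⟩)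
    exact ⟨z, hz, h1 ▸ Set.mem_iUnion.2 ⟨1, hτ 0⟩, h2 ▸ hy⟩
  · refine (congrArg (D.Mem _) ?_).mp (huc _ _ S hS)
    ext x
    constructor
    · intro hx
      obtain ⟨y, hy, z, -, hz, -, h1, h2, -⟩ := hQ x hx
      exact ⟨z, ⟨hz, h1 ▸ hx, h2 ▸ hy⟩, h1⟩
    · rintro ⟨z, hz, rfl⟩
      exact hz.2.1
  · refine (congrArg (D.Mem _) ?_).mp (huc _ _ S hS)
    ext x
    constructor
    · intro hx
      obtain ⟨y, hy, -, z, -, hz, -, -, h1, h2⟩ := hQ x hx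
      exact ⟨z, ⟨hz, h1 ▸ hy, h2 ▸ hx⟩, h2⟩
    · rintro ⟨z, hz, rfl⟩
      exact hz.2.2

end Chains

section Diagrams

variable {k : ℕ} {D : Dependency k}

instance ULit.instFinite (k c m : ℕ) : Finite (ULit k c m) := by
  let X := Fin m ⊕ Fin c
  let f : (X × X) ⊕ (X × X) ⊕ (Fin k → X) → ULit k c m :=
    Sum.elim (fun p => .eq p.1 p.2) (Sum.elim (fun p => .ne p.1 p.2) .rel)
  refine Finite.of_surjective f ?_
  rintro (⟨t₁, t₂⟩ | ⟨t₁, t₂⟩ | ts)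
  · exact ⟨.inl (t₁, t₂), rfl⟩
  · exact ⟨.inr (.inl (t₁, t₂)), rfl⟩
  · exact ⟨.inr (.inr ts), rfl⟩

open Classical in
/-- The formula expressing that exactly the equalities in `τ` hold. -/
noncomputable def equalityType {β : Type} [Finite β] (τ : Set (β × β)) :
    (constLang 0).Formula β :=
  Formula.iInf fun p : β × β =>
    if p ∈ τ then (Term.var p.1).equal (Term.var p.2)
    else ((Term.var p.1).equal (Term.var p.2)).not

theorem realize_equalityType {β A : Type} [Finite β] [(constLang 0).Structure A]
    (τ : Set (β × β)) (v : β → A) :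
    (equalityType τ).Realize v ↔ ∀ p q, (p, q) ∈ τ ↔ v p = v q := by
  simp only [equalityType, Formula.realize_iInf, Prod.forall]
  refine forall₂_congr fun p q => ?_
  split_ifs with h <;> simp [h, Formula.realize_equal]

/-- The strongest U-sentence over `{R}` witnessed by the tuple `a` in `(A, R)` whose formula `θ` is
quantifier-free. -/
noncomputable def diagramSentence {A : Type} (R : Set (Fin k → A)) {m : ℕ} (a : Fin m → A) :
    USentence k 0 where
  m := m
  η := (Set.toFinite {l : ULit k 0 m | l.Realize R Fin.elim0 a}).toFinset.toList
  θ := Formula.iSup fun τ : {τ : Set ((Fin m ⊕ Fin k) × (Fin m ⊕ Fin k)) //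
    ∃ r ∈ R, τ = {p | Sum.elim a r p.1 = Sum.elim a r p.2}} => equalityType τ.1

theorem realize_diagramSentence_iff {A B : Type} (R : Set (Fin k → A)) {m : ℕ} (a : Fin m → A)
    (S : Set (Fin k → B)) :
    (diagramSentence R a).Realize B S Fin.elim0 ↔ ∃ b : Fin m → B,
      (∀ l : ULit k 0 m, l.Realize R Fin.elim0 a → l.Realize S Fin.elim0 b) ∧
      ∀ s ∈ S, ∃ r ∈ R, ∀ p q, Sum.elim a r p = Sum.elim a r q ↔
        Sum.elim b s p = Sum.elim b s q := by
  refine exists_congr fun b => and_congr ?_ (forall₂_congr fun s _ => ?_)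
  · have hmem : ∀ l : ULit k 0 m, l ∈ (diagramSentence R a).η ↔ l.Realize R Fin.elim0 a := by
      intro l
      change l ∈ (Set.toFinite {l : ULit k 0 m | l.Realize R Fin.elim0 a}).toFinset.toList ↔ _
      rw [Finset.mem_toList, Set.Finite.mem_toFinset]
      rfl
    exact forall_congr' fun l => imp_congr_left (hmem l)
  · simp only [diagramSentence, Formula.realize_iSup, Subtype.exists, exists_prop,
      realize_equalityType]
    constructor
    · rintro ⟨_, ⟨r, hr, rfl⟩, h⟩
      exact ⟨r, hr, h⟩
    · rintro ⟨r, hr, h⟩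
      exact ⟨_, ⟨r, hr, rfl⟩, h⟩

/-- `(A, R)` satisfies `D`, but this is not entailed by any single U-sentence true in `(A, R)`. -/
def Dependency.IsUnisolated (D : Dependency k) (A : Type) (R : Set (Fin k → A)) : Prop :=
  D.Mem A R ∧ ∀ χ : USentence k 0, χ.Realize A R Fin.elim0 →
    ∃ (B : Type) (_ : Nonempty B) (S : Set (Fin k → B)), χ.Realize B S Fin.elim0 ∧ ¬ D.Mem B S

theorem Dependency.IsUnisolated.exists_not_mem {A : Type} {R : Set (Fin k → A)}
    (h : D.IsUnisolated A R) (F : Finset A) :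
    ∃ (B : Type) (_ : Nonempty B) (S : Set (Fin k → B)) (b : A → B), ¬ D.Mem B S ∧
      (∀ t ∈ R, (∀ i, t i ∈ F) → (fun i => b (t i)) ∈ S) ∧
      ∀ s ∈ S, ∃ r ∈ R, ∀ p q : A ⊕ Fin k,
        (∀ x, p = .inl x → x ∈ F) → (∀ x, q = .inl x → x ∈ F) →
        (Sum.elim id r p = Sum.elim id r q ↔ Sum.elim b s p = Sum.elim b s q) := by
  classical
  let a : Fin F.card → A := fun i => F.equivFin.symm i
  obtain ⟨B, hB, S, hS, hD⟩ := h.2 (diagramSentence R a)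
    ((realize_diagramSentence_iff R a R).2
      ⟨a, fun _ hl => hl, fun s hs => ⟨s, hs, fun _ _ => .rfl⟩⟩)
  obtain ⟨b, hη, hθ⟩ := (realize_diagramSentence_iff R a S).1 hS
  let b' : A → B := fun x => if hx : x ∈ F then b (F.equivFin ⟨x, hx⟩) else Classical.arbitrary B
  have ha : ∀ x (hx : x ∈ F), a (F.equivFin ⟨x, hx⟩) = x := fun x hx => by simp [a]
  have hb' : ∀ x (hx : x ∈ F), b' x = b (F.equivFin ⟨x, hx⟩) := fun x hx => by simp [b', hx]
  refine ⟨B, hB, S, b', hD, fun t ht htF => ?_, fun s hs => ?_⟩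
  · have hl := hη (.rel fun i => .inl (F.equivFin ⟨t i, htF i⟩))
      (by simpa [ULit.Realize, ha] using ht)
    simpa [ULit.Realize, hb' _ (htF _)] using hl
  · obtain ⟨r, hr, hrs⟩ := hθ s hs
    have hlift : ∀ p : A ⊕ Fin k, (∀ x, p = .inl x → x ∈ F) → ∃ p' : Fin F.card ⊕ Fin k,
        Sum.elim a r p' = Sum.elim id r p ∧ Sum.elim b s p' = Sum.elim b' s p := by
      rintro (x | i) hp
      · exact ⟨.inl (F.equivFin ⟨x, hp x rfl⟩), ha x _, (hb' x _).symm⟩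
      · exact ⟨.inr i, rfl, rfl⟩
    refine ⟨r, hr, fun p q hp hq => ?_⟩
    obtain ⟨p', hp1, hp2⟩ := hlift p hp
    obtain ⟨q', hq1, hq2⟩ := hlift q hq
    rw [← hp1, ← hp2, ← hq1, ← hq2]
    exact hrs p' q'

theorem Dependency.IsUnisolated.exists_extension (hdi : D.DomainIndependent) (huc : D.UnionClosed)
    {ψ : (relLang k).Sentence} (hψ : D.DefinedBy ψ) {A : Type} [Nonempty A] {R : Set (Fin k → A)}
    (h : D.IsUnisolated A R) :
    ∃ (A' : Type) (_ : Nonempty A') (R' : Set (Fin k → A')) (f : A → A') (r : Fin k → A'),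
      D.IsUnisolated A' R' ∧ Function.Injective f ∧ (fun t i => f (t i)) '' R ⊆ R' ∧ r ∈ R' ∧
      ¬ D.Mem A' (insert r ((fun t i => f (t i)) '' R)) := by
  let u : Ultrafilter (Finset A) := Ultrafilter.of Filter.atTop
  have hu : ∀ x : A, ∀ᶠ F in (u : Filter (Finset A)), x ∈ F := fun x =>
    Ultrafilter.of_le _ ((Filter.eventually_ge_atTop {x}).mono fun F hF => hF (by simp))
  choose B hB S b hD hRS hSR using h.exists_not_mem
  let R' : Set (Fin k → (u : Filter (Finset A)).Product fun _ => A) := ultraRel u fun _ => R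
  let j : A → (u : Filter (Finset A)).Product fun _ => A := fun x => ultraMk u fun _ => x
  let S' : Set (Fin k → (u : Filter (Finset A)).Product B) := ultraRel u S
  let j' : A → (u : Filter (Finset A)).Product B := fun x => ultraMk u fun F => b F x
  have hS' : ¬ D.Mem _ S' := by
    rw [hψ.mem_ultraRel_iff]
    intro hS
    obtain ⟨F, hF⟩ := hS.exists
    exact hD F hF
  have hj'S' : (fun t i => j' (t i)) '' R ⊆ S' := by
    rintro _ ⟨t, ht, rfl⟩
    refine (cast_mem_ultraRel _ _).2 ?_
    filter_upwards [Filter.eventually_all.2 fun i => hu (t i)] with F hF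
    exact hRS F t ht hF
  have hr : ∃ r ∈ R', ¬ D.Mem _ (insert r ((fun t i => j (t i)) '' R)) := by
    by_contra! hc
    have hins : ∀ s ∈ S', D.Mem _ (insert s ((fun t i => j' (t i)) '' R)) := by
      intro s hs
      obtain ⟨s, rfl⟩ := exists_rep_tuple s
      have hs' := (cast_mem_ultraRel _ _).1 hs
      have hrep : ∀ F, ∃ r : Fin k → A, (fun i => s i F) ∈ S F → r ∈ R ∧
          ∀ p q : A ⊕ Fin k, (∀ x, p = .inl x → x ∈ F) → (∀ x, q = .inl x → x ∈ F) →
            (Sum.elim id r p = Sum.elim id r q ↔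
              Sum.elim (b F) (fun i => s i F) p = Sum.elim (b F) (fun i => s i F) q) := by
        intro F
        by_cases hF : (fun i => s i F) ∈ S F
        · obtain ⟨r, hr⟩ := hSR F _ hF
          exact ⟨r, fun _ => hr⟩
        · exact ⟨fun _ => Classical.arbitrary A, fun h => (hF h).elim⟩
      choose r hr using hrep
      let code : Option R → Fin k → A ⊕ Fin k := fun o i => o.elim (.inr i) fun t => .inl (t.1 i)
      have hmem := hc (fun i => ultraMk u fun F => r F i)
        ((cast_mem_ultraRel _ _).2 (hs'.mono fun F hF => (hr F hF).1))
      have hrange : ∀ {C : Type} (g : A → C) (w : Fin k → C),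
          insert w ((fun t i => g (t i)) '' R) = Set.range fun o i => Sum.elim g w (code o i) := by
        intro C g w
        ext t
        simp only [Set.mem_insert_iff, Set.mem_image, Set.mem_range, Option.exists, code]
        simp [eq_comm]
      rw [hrange] at hmem ⊢
      refine hdi.mem_range_of_mem_range (fun o o' i i' => ?_) hmem
      have h1 : ∀ p : A ⊕ Fin k, Sum.elim j (fun i => ultraMk u fun F => r F i) p =
          ultraMk u fun F => Sum.elim id (r F) p := by
        rintro (_ | _) <;> rfl
      have h2 : ∀ p : A ⊕ Fin k, Sum.elim j' (fun i => ultraMk u (s i)) p =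
          ultraMk u fun F => Sum.elim (b F) (fun i => s i F) p := by
        rintro (_ | _) <;> rfl
      have hF : ∀ p : A ⊕ Fin k, ∀ᶠ F in (u : Filter (Finset A)), ∀ x, p = .inl x → x ∈ F := by
        rintro (x | i)
        · filter_upwards [hu x] with F hF y hy
          rwa [← Sum.inl_injective hy]
        · exact Filter.Eventually.of_forall fun F x hx => by cases hx
      rw [h1, h1, h2, h2, cast_eq_cast_iff, cast_eq_cast_iff]
      refine Filter.eventually_congr ?_
      filter_upwards [hs', hF (code o i), hF (code o' i')] with F hs hp hq
      exact (hr F hs).2 _ _ hp hq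
    refine hS' ?_
    have hSU : S' = ⋃ s : S', insert s.1 ((fun t i => j' (t i)) '' R) := by
      refine Set.Subset.antisymm (fun s hs => Set.mem_iUnion.2 ⟨⟨s, hs⟩, Or.inl rfl⟩) ?_
      exact Set.iUnion_subset fun s => Set.insert_subset s.2 hj'S'
    rw [hSU]
    exact huc _ _ _ fun s => hins s.1 s.2
  obtain ⟨r, hrR, hr⟩ := hr
  refine ⟨_, Ultraproduct.Product.instNonempty, R', j, r, ⟨?_, fun χ hχ => ?_⟩, ?_, ?_, hrR, hr⟩
  · exact (hψ.mem_ultraRel_iff u _).2 (Filter.Eventually.of_forall fun _ => h.1)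
  · obtain ⟨F, hF⟩ := (USentence.eventually_realize _ χ hχ).exists
    exact h.2 χ hF
  · intro x y hxy
    obtain ⟨F, hF⟩ := ((cast_eq_cast_iff _ _).1 hxy).exists
    exact hF
  · rintro _ ⟨t, ht, rfl⟩
    exact (cast_mem_ultraRel _ _).2 (Filter.Eventually.of_forall fun _ => ht)

theorem Dependency.IsUnisolated.exists_isBreakingChain (hdi : D.DomainIndependent)
    (huc : D.UnionClosed) {ψ : (relLang k).Sentence} (hψ : D.DefinedBy ψ) (n : ℕ) {A : Type}
    [Nonempty A] {R : Set (Fin k → A)} (h : D.IsUnisolated A R) :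
    ∃ (M : Type) (_ : Nonempty M) (f : A → M) (S : ℕ → Set (Fin k → M)) (t : ℕ → Fin k → M),
      Function.Injective f ∧ S 0 = (fun t i => f (t i)) '' R ∧ D.IsBreakingChain n S t := by
  induction n generalizing A R with
  | zero =>
    refine ⟨A, ‹_›, id, fun _ => R, fun _ _ => Classical.arbitrary A, Function.injective_id, ?_, ?_⟩
    · simp
    · exact fun i hi => absurd hi (Nat.not_lt_zero i)
  | succ n ih =>
    obtain ⟨A', hA', R', f, r, hR', hf, hsub, hr, hnot⟩ := h.exists_extension hdi huc hψ
    obtain ⟨M, hM, g, S, t, hg, hS, hchain⟩ := ih hR'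
    refine ⟨M, hM, g ∘ f, fun i => i.casesOn ((fun t i => g (f (t i))) '' R) S,
      fun i => i.casesOn (fun l => g (r l)) t, hg.comp hf, rfl, ?_⟩
    have himg : (fun (t : Fin k → A) i => g (f (t i))) '' R =
        (fun (t : Fin k → A') i => g (t i)) '' ((fun t i => f (t i)) '' R) := by
      rw [Set.image_image]
    rintro (_ | i) hi
    · refine ⟨(hdi.mem_image_iff (hg.comp hf) R).2 h.1, ?_, ?_, ?_⟩
      · intro hmem
        refine hnot ((hdi.mem_image_iff hg _).1 ?_)
        rw [Set.image_insert_eq, ← himg]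
        exact hmem
      · change (fun (t : Fin k → A) i => g (f (t i))) '' R ⊆ S 0
        rw [hS, himg]
        exact Set.image_mono hsub
      · change (fun l => g (r l)) ∈ S 0
        rw [hS]
        exact ⟨r, hr, rfl⟩
    · exact hchain i (Nat.lt_of_succ_lt_succ hi)

end Diagrams

/-- **Global characterization.** Let `D` be a domain-independent, union-closed, strongly first
order dependency, and let `ψ = D(R)` be a first-order sentence over `{R}` defining `D`. Then
`D(R)` is logically equivalent to a finite disjunction of U-sentences over `{R}`. -/
theorem global_characterization {k : ℕ} (D : Dependency k)
    (hdi : D.DomainIndependent) (huc : D.UnionClosed) (hsfo : StronglyFirstOrder D)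
    (ψ : (relLang k).Sentence)
    (hψ : ∀ (A : Type) [Nonempty A] (R : Set (Fin k → A)),
      D.Mem A R ↔ (letI := relStructure A R; Sentence.Realize A ψ)) :
    ∃ χs : List (USentence k 0),
      ∀ (A : Type) [Nonempty A] (R : Set (Fin k → A)),
        (letI := relStructure A R; Sentence.Realize A ψ) ↔
          ∃ χ ∈ χs, USentence.Realize A R Fin.elim0 χ := by
  suffices h : ∃ χs : List (USentence k 0), ∀ (A : Type) [Nonempty A] (R : Set (Fin k → A)),
      D.Mem A R ↔ ∃ χ ∈ χs, USentence.Realize A R Fin.elim0 χ by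
    obtain ⟨χs, h⟩ := h
    exact ⟨χs, fun A _ R => (hψ A R).symm.trans (h A R)⟩
  let 𝒰 : Set (USentence k 0) :=
    {χ | ∀ (A : Type) [Nonempty A] (R : Set (Fin k → A)), χ.Realize A R Fin.elim0 → D.Mem A R}
  by_contra hcon
  have hstep : ∀ F : Finset 𝒰, ∃ (A : Type) (_ : Nonempty A) (R : Set (Fin k → A)),
      D.Mem A R ∧ ∀ χ ∈ F, ¬ USentence.Realize A R Fin.elim0 χ.1 := by
    intro F
    by_contra! hF
    refine hcon ⟨F.toList.map Subtype.val, fun A _ R => ⟨fun hR => ?_, ?_⟩⟩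
    · obtain ⟨χ, hχF, hχ⟩ := hF A ‹_› R hR
      exact ⟨χ.1, List.mem_map.2 ⟨χ, Finset.mem_toList.2 hχF, rfl⟩, hχ⟩
    · rintro ⟨_, hmem, hχ⟩
      obtain ⟨χ, -, rfl⟩ := List.mem_map.1 hmem
      exact χ.2 A R hχ
  choose A hA R hR hF using hstep
  let u : Ultrafilter (Finset 𝒰) := Ultrafilter.of Filter.atTop
  have hbad : D.IsUnisolated _ (ultraRel u R) := by
    refine ⟨(Dependency.DefinedBy.mem_ultraRel_iff hψ u R).2 (Filter.Eventually.of_forall hR),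
      fun χ hχ => ?_⟩
    by_contra! hent
    let χ' : 𝒰 := ⟨χ, fun B hB S => hent B hB S⟩
    have hu : ∀ᶠ F in (u : Filter (Finset 𝒰)), χ' ∈ F :=
      Ultrafilter.of_le _ ((Filter.eventually_ge_atTop {χ'}).mono fun F hF => hF (by simp))
    obtain ⟨F, hF1, hF2⟩ := (hu.and (USentence.eventually_realize R χ hχ)).exists
    exact hF F χ' hF1 hF2
  obtain ⟨n, hn⟩ := Dependency.exists_forall_not_isBreakingChain huc hsfo hψ
  obtain ⟨M, hM, -, S, t, -, -, hchain⟩ := hbad.exists_isBreakingChain hdi huc hψ n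
  exact hn M S t hchain
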